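/- (Remark after Lemma D.3) Let [a,b] ⊆ [0,1] be arbitrary (the endpoints a, b are allowed to coincide with sampling points), let τ : ℝ → ℝ, and set 1^N_{[a,b]}[n] := 1_{[a,b]}(n/N) and (F_τ 1^N_{[a,b]})[n] := 1_{[a,b]}(n/N − τ(n/N)) for n ∈ {0,…,N−1}. Then ‖1^N_{[a,b]} − F_τ 1^N_{[a,b]}‖₂² ≤ 4 N ‖τ‖_∞ + 2. -/

import Mathlib

open scoped BigOperators

noncomputable section

theorem count_near (N : ℕ) (c r : ℝ) (hr : 0 ≤ r) :
    (∑ n : Fin N, if |(n.val : ℝ) - c| ≤ r then (1 : ℝ) else 0) ≤ 2 * r + 1 := by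
  rw [Finset.sum_boole]
  have h : (Finset.univ.filter (fun n : Fin N => |(n.val : ℝ) - c| ≤ r)).card ≤
      (Finset.Icc ⌈c - r⌉ ⌊c + r⌋).card := by
    apply Finset.card_le_card_of_injOn (fun n : Fin N => (n.val : ℤ))
    · intro n hn
      have hn' : |(n.val : ℝ) - c| ≤ r := by simpa using hn
      rw [abs_le] at hn'
      simp only [Finset.coe_Icc, Set.mem_Icc]
      constructor
      · apply Int.ceil_le.mpr
        push_cast
        linarith
      · apply Int.le_floor.mpr
        push_cast
        linarith
    · intro x _ y _ hxy
      apply Fin.ext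
      simpa using hxy
  rw [Int.card_Icc] at h
  have h2 : (((⌊c + r⌋ + 1 - ⌈c - r⌉).toNat : ℤ) : ℝ) ≤ 2 * r + 1 := by
    rw [Int.toNat_eq_max]
    push_cast
    apply max_le
    · linarith [Int.floor_le (c + r), Int.le_ceil (c - r)]
    · linarith
  refine le_trans ?_ h2
  exact_mod_cast h

/-- Remark after Lemma D.3: for arbitrary `[a,b] ⊆ [0,1]` (endpoints may
coincide with sampling points), the sampled indicator satisfies
`‖1^N_{[a,b]} − F_τ 1^N_{[a,b]}‖₂² ≤ 4 N ‖τ‖_∞ + 2` (with `T` any uniform bound on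
`|τ|`, i.e. `T = ‖τ‖_∞`). -/
theorem sampled_indicator_deformation_bound_general
    (N : ℕ) (hN : 0 < N) (a b : ℝ) (ha : 0 ≤ a) (hab : a ≤ b) (hb : b ≤ 1)
    (τ : ℝ → ℝ) (T : ℝ) (hT : ∀ x, |τ x| ≤ T) :
    (∑ n : Fin N,
        |Set.indicator (Set.Icc a b) (fun _ => (1 : ℝ)) ((n.val : ℝ) / (N : ℝ)) -
          Set.indicator (Set.Icc a b) (fun _ => (1 : ℝ))
            ((n.val : ℝ) / (N : ℝ) - τ ((n.val : ℝ) / (N : ℝ)))| ^ 2) ≤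
      4 * N * T + 2 := by
  have hNpos : (0 : ℝ) < N := by exact_mod_cast hN
  have hT0 : 0 ≤ T := le_trans (abs_nonneg _) (hT 0)
  have hr : 0 ≤ N * T := by positivity
  have key : ∀ (n : ℕ) (c : ℝ), |(n : ℝ) / N - c| ≤ T → |(n : ℝ) - N * c| ≤ N * T := by
    intro n c h
    have e : (n : ℝ) - N * c = N * ((n : ℝ) / N - c) := by field_simp
    rw [e, abs_mul, abs_of_pos hNpos]
    exact mul_le_mul_of_nonneg_left h hNpos.le
  have hA := count_near N (N * a) (N * T) hr
  have hB := count_near N (N * b) (N * T) hr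
  refine le_trans (b := (∑ n : Fin N, if |(n.val : ℝ) - N * a| ≤ N * T then (1 : ℝ) else 0) +
    ∑ n : Fin N, if |(n.val : ℝ) - N * b| ≤ N * T then (1 : ℝ) else 0) ?_ (by linarith)
  rw [← Finset.sum_add_distrib]
  apply Finset.sum_le_sum
  intro n _
  have ka := key n.val a
  have kb := key n.val b
  have ht := abs_le.mp (hT ((n.val : ℝ) / N))
  generalize (n.val : ℝ) / N = x at *
  generalize τ x = t at *
  rw [abs_le (a := x - a)] at ka
  rw [abs_le (a := x - b)] at kb
  have nonneg : (0 : ℝ) ≤ (if |(n.val : ℝ) - N * a| ≤ N * T then (1 : ℝ) else 0) +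
      if |(n.val : ℝ) - N * b| ≤ N * T then (1 : ℝ) else 0 := by positivity
  have one : |(n.val : ℝ) - N * a| ≤ N * T ∨ |(n.val : ℝ) - N * b| ≤ N * T →
      (1 : ℝ) ≤ (if |(n.val : ℝ) - N * a| ≤ N * T then (1 : ℝ) else 0) +
      if |(n.val : ℝ) - N * b| ≤ N * T then (1 : ℝ) else 0 := by
    rintro (h | h)
    · rw [if_pos h]; split_ifs <;> norm_num
    · rw [if_pos h]; split_ifs <;> norm_num
  by_cases h1 : x ∈ Set.Icc a b <;> by_cases h2 : x - t ∈ Set.Icc a b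
  · rw [Set.indicator_of_mem h1, Set.indicator_of_mem h2]; simpa using nonneg
  · rw [Set.indicator_of_mem h1, Set.indicator_of_notMem h2]
    rw [sub_zero, abs_one, one_pow]
    apply one
    rw [Set.mem_Icc, not_and_or, not_le, not_le] at h2
    obtain ⟨h3, h4⟩ := h1
    rcases h2 with h2 | h2
    · exact Or.inl (ka ⟨by linarith, by linarith⟩)
    · exact Or.inr (kb ⟨by linarith, by linarith⟩)
  · rw [Set.indicator_of_notMem h1, Set.indicator_of_mem h2]
    rw [zero_sub, abs_neg, abs_one, one_pow]
    apply one
    rw [Set.mem_Icc, not_and_or, not_le, not_le] at h1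
    obtain ⟨h3, h4⟩ := h2
    rcases h1 with h1 | h1
    · exact Or.inl (ka ⟨by linarith, by linarith⟩)
    · exact Or.inr (kb ⟨by linarith, by linarith⟩)
  · rw [Set.indicator_of_notMem h1, Set.indicator_of_notMem h2]; simpa using nonneg

end
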